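/- arXiv:1109.1505 — 2 statements merged into one kernel-verified Lean document; each statement's English description precedes it below -/
import Mathlib

section
/- Let A be an m × m real matrix whose off-diagonal entries are all positive and whose column sums are all nonpositive (zero or negative), and let z ∈ ℝ^m have all entries positive. If A has maximal rank m (A is invertible), then the unique solution x of the linear system A x + z = 0 has all entries nonnegative. -/
open scoped BigOperators

/-- let `A` be an `m × m` real matrix (`m ≥ 1`) whose off-diagonal
entries are all positive and whose column sums are all nonpositive, and let `z` have
all entries positive. If `A` has maximal rank `m` (i.e., is invertible), then the
unique solution `x` of the linear system `A x + z = 0` has all entries nonnegative. -/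
theorem statement_17 (m : ℕ) (hm : 1 ≤ m) (A : Matrix (Fin m) (Fin m) ℝ)
    (hoff : ∀ i j, i ≠ j → 0 < A i j)
    (hcol : ∀ j, (∑ i, A i j) ≤ 0)
    (z : Fin m → ℝ) (hz : ∀ i, 0 < z i)
    (hrank : A.rank = m)
    (x : Fin m → ℝ) (hx : A.mulVec x + z = 0) :
    ∀ i, 0 ≤ x i := by
  classical
  intro k
  by_contra hk
  set N : Finset (Fin m) := Finset.univ.filter (fun i => x i < 0) with hN
  have hkN : k ∈ N := by simp [hN]; linarith
  have h1 : ∑ i ∈ N, A.mulVec x i < 0 := by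
    apply Finset.sum_neg
    · intro i _
      have h := congrFun hx i
      simp only [Pi.add_apply, Pi.zero_apply] at h
      linarith [hz i]
    · exact ⟨k, hkN⟩
  have h2 : ∑ i ∈ N, A.mulVec x i = ∑ j, (∑ i ∈ N, A i j) * x j := by
    simp only [Matrix.mulVec, dotProduct, Finset.sum_mul]
    exact Finset.sum_comm
  have h3 : 0 ≤ ∑ j, (∑ i ∈ N, A i j) * x j := by
    apply Finset.sum_nonneg
    intro j _
    by_cases hj : x j < 0
    · apply mul_nonneg_of_nonpos_of_nonpos _ hj.le
      have h4 := Finset.sum_add_sum_compl N (fun i => A i j)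
      have h5 : 0 ≤ ∑ i ∈ Nᶜ, A i j := by
        apply Finset.sum_nonneg
        intro i hi
        apply (hoff i j _).le
        rintro rfl
        simp [hN] at hi
        linarith
      linarith [hcol j]
    · apply mul_nonneg _ (not_lt.mp hj)
      apply Finset.sum_nonneg
      intro i hi
      apply (hoff i j _).le
      rintro rfl
      simp [hN] at hi
      exact hj hi
  linarith
end

section
/- Let Sα ⊆ {1,…,s} be a non-interacting set of species in a CRN whose complexes have natural-number entries, let k_r > 0 be a rate constant for each reaction r, and for each species i let f_i be the mass-action steady-state polynomial f_i(c) = ∑_{r=(y,y') ∈ R} k_r (∏_{u=1}^s c_u^{y_u}) (y'_i − y_i). Then for every i ∈ Sα there exist polynomials a_{ij} (for j ∈ Sα) and z_i in the variables { c_u : u ∉ Sα } such that f_i = ∑_{j ∈ Sα} a_{ij} c_j + z_i, where z_i and each a_{ij} with j ≠ i have only nonnegative coefficients, a_{ii} has only nonpositive coefficients, and moreover z_i = 0 for all i ∈ Sα and ∑_{i ∈ Sα} a_{ij} = 0 for all j ∈ Sα if and only if Sα is a cut. -/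
open scoped BigOperators

theorem aux_eq_zero_of_nonneg {σ ι : Type*} (R : Finset ι) (m : ι → σ →₀ ℕ) (c : ι → ℝ)
    (hc : ∀ r ∈ R, 0 ≤ c r) (h : ∑ r ∈ R, MvPolynomial.monomial (m r) (c r) = 0) :
    ∀ r ∈ R, c r = 0 := by
  have h1 := congrArg (MvPolynomial.eval (fun _ => (1 : ℝ))) h
  simp only [map_sum, map_zero, MvPolynomial.eval_monomial] at h1
  simp only [one_pow, Finsupp.prod, Finset.prod_const_one, mul_one] at h1
  exact (Finset.sum_eq_zero_iff_of_nonneg hc).1 h1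

theorem aux_vars {s : ℕ} {ι : Type*} (R : Finset ι) (m : ι → Fin s →₀ ℕ) (c : ι → ℝ)
    (S : Finset (Fin s)) (hm : ∀ r, ∀ u ∈ S, m r u = 0) :
    ∀ u ∈ (∑ r ∈ R, MvPolynomial.monomial (m r) (c r)).vars, u ∉ S := by
  classical
  intro u hu hS
  have h1 := MvPolynomial.vars_sum_subset R (fun r => MvPolynomial.monomial (m r) (c r)) hu
  simp only [Finset.mem_biUnion] at h1
  obtain ⟨r, -, hr⟩ := h1
  by_cases h0 : c r = 0
  · simp [h0] at hr
  · rw [MvPolynomial.vars_monomial h0] at hr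
    simp [hm r u hS] at hr

theorem aux_coeff {σ ι : Type*} (R : Finset ι) (m : ι → σ →₀ ℕ) (c : ι → ℝ)
    (hc : ∀ r ∈ R, 0 ≤ c r) (d : σ →₀ ℕ) :
    0 ≤ (∑ r ∈ R, MvPolynomial.monomial (m r) (c r)).coeff d := by
  classical
  rw [MvPolynomial.coeff_sum]
  refine Finset.sum_nonneg fun r hr => ?_
  rw [MvPolynomial.coeff_monomial]
  split_ifs
  · exact hc r hr
  · exact le_rfl

theorem aux_coeff_nonpos {σ ι : Type*} (R : Finset ι) (m : ι → σ →₀ ℕ) (c : ι → ℝ)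
    (hc : ∀ r ∈ R, c r ≤ 0) (d : σ →₀ ℕ) :
    (∑ r ∈ R, MvPolynomial.monomial (m r) (c r)).coeff d ≤ 0 := by
  classical
  rw [MvPolynomial.coeff_sum]
  refine Finset.sum_nonpos fun r hr => ?_
  rw [MvPolynomial.coeff_monomial]
  split_ifs
  · exact hc r hr
  · exact le_rfl

/-- Lemma "Slinear2" of the paper: let `Sα` be a non-interacting set of
species of a CRN with natural-number complexes and positive rate constants `k r`, and
for each species `i` let `f i` be the mass-action steady-state polynomial
`f i = ∑_{r=(y,y') ∈ R} k r • (∏ u, c u ^ y u) * (y' i − y i)`.  Then for every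
`i ∈ Sα` the polynomial `f i` decomposes as `f i = ∑ j ∈ Sα, a i j * X j + z i`, where
`z i` and the `a i j` are polynomials only in the variables outside `Sα`, `z i` and
`a i j` (for `j ≠ i`) have nonnegative coefficients, `a i i` has nonpositive
coefficients, and moreover `z i = 0` for all `i ∈ Sα` together with
`∑ i ∈ Sα, a i j = 0` for all `j ∈ Sα` holds if and only if `Sα` is a cut
(full and non-interacting). -/
theorem statement_18 (s : ℕ) (C : Finset (Fin s → ℕ))
    (R : Finset ((Fin s → ℕ) × (Fin s → ℕ)))
    (hR : ∀ r ∈ R, r.1 ∈ C ∧ r.2 ∈ C ∧ r.1 ≠ r.2)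
    (hcov : ∀ y ∈ C, ∃ r ∈ R, r.1 = y ∨ r.2 = y)
    (k : (Fin s → ℕ) × (Fin s → ℕ) → ℝ) (hk : ∀ r ∈ R, 0 < k r)
    (Sα : Finset (Fin s))
    (hNI : (∀ i ∈ Sα, ∀ j ∈ Sα, i ≠ j → ¬ ∃ y ∈ C, y i ≠ 0 ∧ y j ≠ 0) ∧
           (∀ y ∈ C, ∀ i ∈ Sα, y i = 0 ∨ y i = 1))
    (f : Fin s → MvPolynomial (Fin s) ℝ)
    (hf : ∀ i, f i = ∑ r ∈ R,
      MvPolynomial.C (k r * ((r.2 i : ℝ) - (r.1 i : ℝ))) *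
        ∏ u, MvPolynomial.X u ^ r.1 u) :
    ∃ (a : Fin s → Fin s → MvPolynomial (Fin s) ℝ)
      (z : Fin s → MvPolynomial (Fin s) ℝ),
      (∀ i ∈ Sα,
        (f i = (∑ j ∈ Sα, a i j * MvPolynomial.X j) + z i) ∧
        (∀ u ∈ (z i).vars, u ∉ Sα) ∧
        (∀ j ∈ Sα, ∀ u ∈ (a i j).vars, u ∉ Sα) ∧
        (∀ d : Fin s →₀ ℕ, 0 ≤ (z i).coeff d) ∧
        (∀ j ∈ Sα, j ≠ i → ∀ d : Fin s →₀ ℕ, 0 ≤ (a i j).coeff d) ∧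
        (∀ d : Fin s →₀ ℕ, (a i i).coeff d ≤ 0)) ∧
      (((∀ i ∈ Sα, z i = 0) ∧ (∀ j ∈ Sα, (∑ i ∈ Sα, a i j) = 0)) ↔
        ((∀ r ∈ R, (∃ i ∈ Sα, r.1 i ≠ 0 ∨ r.2 i ≠ 0) →
            ∃ j ∈ Sα, ∃ l ∈ Sα, r.1 j ≠ 0 ∧ r.2 l ≠ 0) ∧
         (∀ i ∈ Sα, ∀ j ∈ Sα, i ≠ j → ¬ ∃ y ∈ C, y i ≠ 0 ∧ y j ≠ 0) ∧
         (∀ y ∈ C, ∀ i ∈ Sα, y i = 0 ∨ y i = 1))) := by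
  classical
  obtain ⟨hN1, hN2⟩ := hNI
  let m : (Fin s → ℕ) × (Fin s → ℕ) → Fin s →₀ ℕ := fun r =>
    Finsupp.equivFunOnFinite.symm (fun u => if u ∈ Sα then 0 else r.1 u)
  have hm0 : ∀ r, ∀ u ∈ Sα, m r u = 0 := by
    intro r u hu
    simp [m, hu]
  have hexcl : ∀ y ∈ C, ∀ j ∈ Sα, y j ≠ 0 → ∀ i ∈ Sα, i ≠ j → y i = 0 := by
    intro y hy j hj hyj i hi hij
    by_contra h
    exact hN1 i hi j hj hij ⟨y, hy, h, hyj⟩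
  have hone : ∀ y ∈ C, ∀ j ∈ Sα, y j ≠ 0 → y j = 1 := fun y hy j hj h =>
    (hN2 y hy j hj).resolve_left h
  have hsum1 : ∀ y ∈ C, ∀ j ∈ Sα, y j ≠ 0 → ∑ i ∈ Sα, (y i : ℝ) = 1 := by
    intro y hy j hj hyj
    rw [Finset.sum_eq_single_of_mem j hj]
    · simp [hone y hy j hj hyj]
    · intro i hi hij
      simp [hexcl y hy j hj hyj i hi hij]
  have hsumle : ∀ y ∈ C, ∑ i ∈ Sα, (y i : ℝ) ≤ 1 := by
    intro y hy
    by_cases h : ∃ j ∈ Sα, y j ≠ 0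
    · obtain ⟨j, hj, hyj⟩ := h
      exact (hsum1 y hy j hj hyj).le
    · push Not at h
      rw [Finset.sum_eq_zero]
      · norm_num
      · intro i hi
        simp [h i hi]
  let cz : Fin s → (Fin s → ℕ) × (Fin s → ℕ) → ℝ := fun i r =>
    if ∀ j ∈ Sα, r.1 j = 0 then k r * (r.2 i : ℝ) else 0
  let ca : Fin s → Fin s → (Fin s → ℕ) × (Fin s → ℕ) → ℝ := fun i j r =>
    k r * ((r.2 i : ℝ) - (r.1 i : ℝ)) * (r.1 j : ℝ)
  have hcz : ∀ i, ∀ r ∈ R, 0 ≤ cz i r := by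
    intro i r hr
    have := hk r hr
    simp only [cz]
    split_ifs
    · positivity
    · exact le_rfl
  have hcol : ∀ j, ∑ i ∈ Sα, (∑ r ∈ R, MvPolynomial.monomial (m r) (ca i j r)) =
      ∑ r ∈ R, MvPolynomial.monomial (m r) (∑ i ∈ Sα, ca i j r) := by
    intro j
    rw [Finset.sum_comm]
    simp only [map_sum]
  have hcs : ∀ j r, ∑ i ∈ Sα, ca i j r =
      k r * ((∑ i ∈ Sα, (r.2 i : ℝ)) - ∑ i ∈ Sα, (r.1 i : ℝ)) * (r.1 j : ℝ) := by
    intro j r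
    simp only [ca]
    rw [← Finset.sum_mul, ← Finset.mul_sum, Finset.sum_sub_distrib]
  have hcsle : ∀ j ∈ Sα, ∀ r ∈ R, ∑ i ∈ Sα, ca i j r ≤ 0 := by
    intro j hj r hr
    rw [hcs]
    by_cases h0 : r.1 j = 0
    · simp [h0]
    · rw [hsum1 r.1 (hR r hr).1 j hj h0, hone r.1 (hR r hr).1 j hj h0]
      have h1 := hsumle r.2 (hR r hr).2.1
      have := hk r hr
      push_cast
      nlinarith
  refine ⟨fun i j => ∑ r ∈ R, MvPolynomial.monomial (m r) (ca i j r),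
    fun i => ∑ r ∈ R, MvPolynomial.monomial (m r) (cz i r), ?_, ?_⟩
  · intro i hi
    refine ⟨?_, aux_vars R m _ Sα hm0, fun j _ => aux_vars R m _ Sα hm0,
      aux_coeff R m _ (hcz i), ?_, ?_⟩
    · rw [hf]
      simp only [Finset.sum_mul]
      rw [Finset.sum_comm, ← Finset.sum_add_distrib]
      refine Finset.sum_congr rfl fun r hr => ?_
      have hprod : (∏ u, (MvPolynomial.X u : MvPolynomial (Fin s) ℝ) ^ r.1 u) =
          MvPolynomial.monomial (Finsupp.equivFunOnFinite.symm r.1) 1 := by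
        rw [MvPolynomial.monomial_eq, Finsupp.prod_fintype _ _ (fun i => pow_zero _)]
        simp
      rw [hprod, MvPolynomial.C_mul_monomial, mul_one]
      by_cases h : ∃ j ∈ Sα, r.1 j ≠ 0
      · obtain ⟨j, hj, hyj⟩ := h
        have hz : cz i r = 0 := by
          simp only [cz]
          rw [if_neg]
          intro h
          exact hyj (h j hj)
        rw [hz, map_zero, add_zero, Finset.sum_eq_single_of_mem j hj]
        · rw [MvPolynomial.X, MvPolynomial.monomial_mul, mul_one]
          have e : Finsupp.equivFunOnFinite.symm r.1 = m r + Finsupp.single j 1 := by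
            ext u
            by_cases huj : u = j
            · subst huj
              simp [m, hj, hone r.1 (hR r hr).1 u hj hyj]
            · by_cases huS : u ∈ Sα
              · simp [m, huS, hexcl r.1 (hR r hr).1 j hj hyj u huS huj, Ne.symm huj]
              · simp [m, huS, Ne.symm huj]
          rw [e]
          simp [ca, hone r.1 (hR r hr).1 j hj hyj]
        · intro l hl hlj
          simp [ca, hexcl r.1 (hR r hr).1 j hj hyj l hl hlj]
      · push Not at h
        have hz : cz i r = k r * (r.2 i : ℝ) := by
          simp only [cz]
          rw [if_pos h]
        rw [hz, Finset.sum_eq_zero, zero_add]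
        · have e : Finsupp.equivFunOnFinite.symm r.1 = m r := by
            ext u
            by_cases huS : u ∈ Sα
            · simp [m, huS, h u huS]
            · simp [m, huS]
          rw [e]
          simp [h i hi]
        · intro l hl
          simp [ca, h l hl]
    · intro j hj hji
      refine aux_coeff R m _ fun r hr => ?_
      have := hk r hr
      simp only [ca]
      by_cases h0 : r.1 j = 0
      · simp [h0]
      · rw [hexcl r.1 (hR r hr).1 j hj h0 i hi (Ne.symm hji)]
        simp only [Nat.cast_zero, sub_zero]
        positivity
    · refine aux_coeff_nonpos R m _ fun r hr => ?_
      have := hk r hr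
      simp only [ca]
      rcases hN2 r.1 (hR r hr).1 i hi with h | h <;>
        rcases hN2 r.2 (hR r hr).2.1 i hi with h' | h' <;> simp [h, h', this.le]
  · constructor
    · rintro ⟨hz, ha⟩
      refine ⟨?_, hN1, hN2⟩
      intro r hr hex
      have hkr := hk r hr
      by_cases h1 : ∃ j ∈ Sα, r.1 j ≠ 0
      · obtain ⟨j, hj, hyj⟩ := h1
        by_contra hcon
        have h2 : ∀ l ∈ Sα, r.2 l = 0 := by
          intro l hl
          by_contra h
          exact hcon ⟨j, hj, l, hl, hyj, h⟩
        have h3 := ha j hj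
        simp only [hcol] at h3
        have h4 := aux_eq_zero_of_nonneg R m (fun r => - ∑ i ∈ Sα, ca i j r)
          (fun r hr => neg_nonneg.2 (hcsle j hj r hr))
          (by simp only [map_neg, Finset.sum_neg_distrib, h3, neg_zero]) r hr
        have h6 : ∑ i ∈ Sα, (r.2 i : ℝ) = 0 :=
          Finset.sum_eq_zero fun l hl => by simp [h2 l hl]
        simp only [hcs] at h4
        rw [hsum1 r.1 (hR r hr).1 j hj hyj, hone r.1 (hR r hr).1 j hj hyj, h6] at h4
        norm_num at h4
        linarith
      · push Not at h1
        exfalso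
        obtain ⟨i, hi, h⟩ := hex
        have h2 : r.2 i ≠ 0 := h.resolve_left (fun h => h (h1 i hi))
        have h4 := aux_eq_zero_of_nonneg R m (cz i) (hcz i) (hz i hi) r hr
        simp only [cz] at h4
        rw [if_pos h1] at h4
        have : (r.2 i : ℝ) ≠ 0 := by exact_mod_cast h2
        exact (mul_ne_zero hkr.ne' this) h4
    · rintro ⟨hfull, -, -⟩
      constructor
      · intro i hi
        refine Finset.sum_eq_zero fun r hr => ?_
        have : cz i r = 0 := by
          simp only [cz]
          split_ifs with h
          · have : r.2 i = 0 := by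
              by_contra h2
              obtain ⟨j, hj, l, hl, hj1, -⟩ := hfull r hr ⟨i, hi, Or.inr h2⟩
              exact hj1 (h j hj)
            simp [this]
          · rfl
        rw [this, map_zero]
      · intro j hj
        simp only [hcol]
        refine Finset.sum_eq_zero fun r hr => ?_
        rw [hcs]
        by_cases h0 : r.1 j = 0
        · simp [h0]
        · obtain ⟨_, _, l, hl, -, hl1⟩ := hfull r hr ⟨j, hj, Or.inl h0⟩
          rw [hsum1 r.1 (hR r hr).1 j hj h0, hsum1 r.2 (hR r hr).2.1 l hl hl1]
          simp
end
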